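/- Let d, s ∈ ℕ and Λ = s·ℤ^d. Let 𝒫_ifm(s,d) denote the set of integral polyhedra P ⊆ ℝ^d that are Λ-free and inclusion-maximal among integral Λ-free polyhedra. Then there exist finitely many polyhedra Q₁, …, Q_N ∈ 𝒫_ifm(s,d) such that every P ∈ 𝒫_ifm(s,d) satisfies P = U·Q_j + v for some matrix U ∈ ℤ^{d×d} with |det U| = 1, some vector v ∈ Λ, and some j ∈ {1, …, N}. In other words, 𝒫_ifm(s,d) modulo Λ-preserving affine transformations is a finite set. -/

import Mathlib

open Set

/-- The set of integer points `ℤ^d` inside `ℝ^d`. -/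
def intPts (d : ℕ) : Set (Fin d → ℝ) := {x | ∀ i, ∃ z : ℤ, x i = (z : ℝ)}

/-- The lattice `Λ = s·ℤ^d` inside `ℝ^d`. -/
def sLat (d s : ℕ) : Set (Fin d → ℝ) := {x | ∀ i, ∃ z : ℤ, x i = (s : ℝ) * (z : ℝ)}

/-- A polyhedron: a finite intersection of closed halfspaces. -/
def IsPolyhedron {d : ℕ} (P : Set (Fin d → ℝ)) : Prop :=
  ∃ (n : ℕ) (A : Fin n → Fin d → ℝ) (b : Fin n → ℝ),
    P = {x | ∀ i, (∑ j, A i j * x j) ≤ b i}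

/-- An integral set: it equals the convex hull of its integer points. -/
def IsIntegralPoly {d : ℕ} (P : Set (Fin d → ℝ)) : Prop :=
  P = convexHull ℝ (P ∩ intPts d)

/-- The affine map `x ↦ U·x + t` with integer matrix `U` and translation `t : ℝ^d`. -/
noncomputable def affMap {d : ℕ} (U : Matrix (Fin d) (Fin d) ℤ) (t : Fin d → ℝ)
    (x : Fin d → ℝ) : Fin d → ℝ := fun i => (∑ j, (U i j : ℝ) * x j) + t i

/-- An integral `Λ`-free polyhedron, where `Λ = s·ℤ^d`. -/
def IsIntLatFree (d s : ℕ) (P : Set (Fin d → ℝ)) : Prop :=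
  IsPolyhedron P ∧ IsIntegralPoly P ∧ interior P ∩ sLat d s = ∅

/-- Membership in `𝒫_ifm(s,d)`: an integral `Λ`-free polyhedron which is
inclusion-maximal among integral `Λ`-free polyhedra. -/
def MemPifm (d s : ℕ) (P : Set (Fin d → ℝ)) : Prop :=
  IsIntLatFree d s P ∧ ∀ Q : Set (Fin d → ℝ), IsIntLatFree d s Q → P ⊆ Q → P = Q

/-- Simultaneous Diophantine approximation. -/
theorem exists_simultaneous_approx {κ : Type*} [Fintype κ] (x : κ → ℝ) (N : ℕ) (hN : 1 ≤ N) :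
    ∃ t : ℕ, 1 ≤ t ∧ t ≤ N ^ Fintype.card κ ∧ ∃ m : κ → ℤ, ∀ i, |t * x i - m i| ≤ 1 / N := by
  classical
  have hN0 : (0 : ℝ) < N := by exact_mod_cast hN
  have hlt : ∀ (t : ℕ) (i : κ), ⌊Int.fract (t * x i) * N⌋₊ < N := by
    intro t i
    rw [Nat.floor_lt (by positivity [Int.fract_nonneg (t * x i)])]
    nlinarith [Int.fract_lt_one (t * x i)]
  let f : ℕ → κ → Fin N := fun t i => ⟨⌊Int.fract (t * x i) * N⌋₊, hlt t i⟩
  obtain ⟨a, ha, b, hb, hab, hf⟩ : ∃ a ∈ Finset.range (N ^ Fintype.card κ + 1),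
      ∃ b ∈ Finset.range (N ^ Fintype.card κ + 1), a ≠ b ∧ f a = f b := by
    apply Finset.exists_ne_map_eq_of_card_lt_of_maps_to (t := Finset.univ)
    · simp
    · simp [Set.MapsTo]
  wlog h : a < b generalizing a b
  · exact this b hb a ha hab.symm hf.symm (lt_of_le_of_ne (not_lt.1 h) hab.symm)
  simp only [Finset.mem_range] at ha hb
  refine ⟨b - a, by omega, by omega, fun i => ⌊b * x i⌋ - ⌊a * x i⌋, fun i => ?_⟩
  have h1 : ⌊Int.fract (a * x i) * N⌋₊ = ⌊Int.fract (b * x i) * N⌋₊ :=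
    congrArg Fin.val (congrFun hf i)
  have e1 := Nat.floor_le (mul_nonneg (Int.fract_nonneg (a * x i)) hN0.le)
  have e2 := Nat.lt_floor_add_one (Int.fract (a * x i) * N)
  have e3 := Nat.floor_le (mul_nonneg (Int.fract_nonneg (b * x i)) hN0.le)
  have e4 := Nat.lt_floor_add_one (Int.fract (b * x i) * N)
  rw [h1] at e1 e2
  have : ((b - a : ℕ) : ℝ) * x i - ((⌊b * x i⌋ - ⌊a * x i⌋ : ℤ) : ℝ)
      = Int.fract (b * x i) - Int.fract (a * x i) := by
    rw [Nat.cast_sub h.le]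
    push_cast
    simp only [Int.fract]
    ring
  rw [this, abs_le]
  constructor
  · rw [← neg_div, div_le_iff₀ hN0]; linarith
  · rw [le_div_iff₀ hN0]; linarith

/-- Nonnegative coefficient vectors obtained from `α` by integral affine operations, modulo `s`,
that keep the coefficient sum and do not lose positivity. -/
def CoeffReach {ι : Type*} [Fintype ι] (s : ℕ) (α β : ι → ℝ) : Prop :=
  ∃ (t : ℕ) (m : ι → ℤ), ∑ i, m i = -(t : ℤ) ∧ (∀ i, β i = α i + s * (t * α i + m i)) ∧
    (∀ i, 0 ≤ β i) ∧ ∀ i, 0 < α i → 0 < β i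

theorem CoeffReach.refl {ι : Type*} [Fintype ι] (s : ℕ) {α : ι → ℝ} (h : ∀ i, 0 ≤ α i) :
    CoeffReach s α α :=
  ⟨0, 0, by simp, by simp, h, fun _ => id⟩

theorem CoeffReach.trans {ι : Type*} [Fintype ι] {s : ℕ} {α β γ : ι → ℝ}
    (h₁ : CoeffReach s α β) (h₂ : CoeffReach s β γ) : CoeffReach s α γ := by
  obtain ⟨t, m, hm, hβ, -, hpos⟩ := h₁
  obtain ⟨t', m', hm', hγ, hγ0, hpos'⟩ := h₂
  refine ⟨t + t' + s * t * t', fun i => (1 + s * t') * m i + m' i, ?_, fun i => ?_, hγ0,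
    fun i hi => hpos' i (hpos i hi)⟩
  · rw [Finset.sum_add_distrib, ← Finset.mul_sum, hm, hm']
    push_cast
    ring
  · rw [hγ, hβ]
    push_cast
    ring

theorem CoeffReach.sum_eq_one {ι : Type*} [Fintype ι] {s : ℕ} {α β : ι → ℝ}
    (h : CoeffReach s α β) (hα : ∑ i, α i = 1) : ∑ i, β i = 1 := by
  obtain ⟨t, m, hm, hβ, -⟩ := h
  have hm' : ∑ i, (m i : ℝ) = -(t : ℝ) := by exact_mod_cast hm
  simp only [hβ, Finset.sum_add_distrib, ← Finset.mul_sum, hα, hm']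
  ring

theorem CoeffReach.exists_step {ι : Type*} [Fintype ι] [DecidableEq ι] {s M N : ℕ} (hs : 1 ≤ s)
    (hM : Fintype.card ι ≤ M) (hN : 1 ≤ N) (K : Finset ι) {β : ι → ℝ} (hβ : ∀ i, 0 ≤ β i)
    (hsum : ∑ i, β i = 1) (hη : (N : ℝ) ^ M * ∑ i ∈ Kᶜ, β i ≤ 1 / 4) (hMN : (M : ℝ) / N ≤ 1 / 4)
    (hK : ∀ i ∈ K, (s : ℝ) / N < β i) :
    ∃ β', CoeffReach s β β' ∧ (∀ i ∈ K, β i - s / N ≤ β' i) ∧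
      2 * ∑ i ∈ Kᶜ, β i ≤ ∑ i ∈ Kᶜ, β' i := by
  obtain ⟨t, ht, htN, m, hm⟩ := exists_simultaneous_approx (fun i : K => β i) N hN
  have hN0 : (0 : ℝ) < N := by exact_mod_cast hN
  have ht1 : (1 : ℝ) ≤ t := by exact_mod_cast ht
  have hs1 : (1 : ℝ) ≤ s := by exact_mod_cast hs
  have hcard : Fintype.card K ≤ M := by
    rw [Fintype.card_coe]; exact (Finset.card_le_univ K).trans hM
  have htM : (t : ℝ) ≤ (N : ℝ) ^ M := by
    exact_mod_cast htN.trans (Nat.pow_le_pow_right hN hcard)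
  have hη0 : 0 ≤ ∑ i ∈ Kᶜ, β i := Finset.sum_nonneg fun i _ => hβ i
  let m' : ι → ℤ := fun i => if h : i ∈ K then - m ⟨i, h⟩ else 0
  have hmK : ∀ i ∈ K, |t * β i + m' i| ≤ 1 / N := by
    intro i hi
    simpa [m', hi, sub_eq_add_neg] using hm ⟨i, hi⟩
  have hmKc : ∀ i ∉ K, m' i = 0 := fun i hi => by simp [m', hi]
  have hmsum : ∑ i, m' i = -(t : ℤ) := by
    have h1 : (t : ℝ) + ∑ i, (m' i : ℝ) = ∑ i ∈ K, (t * β i + m' i) + t * ∑ i ∈ Kᶜ, β i := by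
      have h2 : ∑ i ∈ Kᶜ, ((t : ℝ) * β i + m' i) = t * ∑ i ∈ Kᶜ, β i := by
        rw [Finset.mul_sum]
        refine Finset.sum_congr rfl fun i hi => ?_
        simp [hmKc i (Finset.mem_compl.1 hi)]
      rw [← h2, Finset.sum_add_sum_compl, Finset.sum_add_distrib, ← Finset.mul_sum, hsum, mul_one]
    have h3 : |∑ i ∈ K, (t * β i + m' i)| ≤ M / N := by
      calc |∑ i ∈ K, (t * β i + m' i)| ≤ ∑ i ∈ K, |t * β i + m' i| := Finset.abs_sum_le_sum_abs _ _
        _ ≤ ∑ i ∈ K, (1 : ℝ) / N := Finset.sum_le_sum hmK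
        _ = K.card * (1 / N) := by simp
        _ ≤ M * (1 / N) := by
          gcongr
          exact (Finset.card_le_univ K).trans hM
        _ = M / N := by ring
    have h4 : t * ∑ i ∈ Kᶜ, β i ≤ 1 / 4 := (mul_le_mul_of_nonneg_right htM hη0).trans hη
    have h5 : 0 ≤ t * ∑ i ∈ Kᶜ, β i := by positivity
    have h6 : |((t + ∑ i, m' i : ℤ) : ℝ)| < 1 := by
      push_cast
      rw [h1]
      rw [abs_le] at h3
      rw [abs_lt]
      constructor <;> linarith
    have h7 : |(t : ℤ) + ∑ i, m' i| < 1 := by exact_mod_cast h6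
    have h8 := Int.abs_lt_one_iff.1 h7
    linarith
  have hdrift : ∀ i ∈ K, β i - s / N ≤ β i + s * (t * β i + m' i) := by
    intro i hi
    have := (abs_le.1 (hmK i hi)).1
    have h2 : (s : ℝ) * (-(1 / N)) ≤ s * (t * β i + m' i) := by gcongr
    calc β i - s / N = β i + s * (-(1 / N)) := by ring
      _ ≤ _ := by linarith
  refine ⟨fun i => β i + s * (t * β i + m' i), ⟨t, m', hmsum, fun _ => rfl, fun i => ?_,
    fun i hi => ?_⟩, hdrift, ?_⟩
  · by_cases h : i ∈ K
    · have := hdrift i h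
      have := hK i h
      dsimp only
      linarith
    · have := hβ i
      simp only [hmKc i h, Int.cast_zero, add_zero]
      positivity
  · by_cases h : i ∈ K
    · have := hdrift i h
      have := hK i h
      dsimp only
      linarith
    · simp only [hmKc i h, Int.cast_zero, add_zero]
      positivity
  · rw [Finset.mul_sum]
    refine Finset.sum_le_sum fun i hi => ?_
    have h0 := hβ i
    simp only [hmKc i (Finset.mem_compl.1 hi), Int.cast_zero, add_zero]
    have : 1 * β i ≤ s * (t * β i) := by
      rw [← mul_assoc]; gcongr; nlinarith
    linarith

theorem CoeffReach.exists_large {ι : Type*} [Fintype ι] [DecidableEq ι] {s M : ℕ} (hs : 1 ≤ s)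
    (hM : Fintype.card ι ≤ M) (hM1 : 1 ≤ M) (K : Finset ι) {δ δ₁ η₁ C : ℝ} (hδ₁ : 0 < δ₁)
    (hC : 8 * s ≤ C * ((2 : ℝ) ^ (1 / M : ℝ) - 1)) (hη₁ : 4 * η₁ ≤ 1)
    (hη₁M : 8 * M * η₁ ^ (1 / M : ℝ) ≤ 1 / 4)
    (hδ : δ₁ + (C + 8 * s) * η₁ ^ (1 / M : ℝ) ≤ δ) (r : ℕ) :
    ∀ β : ι → ℝ, (∀ i, 0 ≤ β i) → ∑ i, β i = 1 →
      (∀ i ∈ K, δ - C * (∑ i ∈ Kᶜ, β i) ^ (1 / M : ℝ) ≤ β i) →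
      0 < ∑ i ∈ Kᶜ, β i → ∑ i ∈ Kᶜ, β i < η₁ → η₁ ≤ 2 ^ r * ∑ i ∈ Kᶜ, β i →
      ∃ β', CoeffReach s β β' ∧ (∀ i ∈ K, δ₁ ≤ β' i) ∧ η₁ ≤ ∑ i ∈ Kᶜ, β' i := by
  induction r with
  | zero => intro β _ _ _ _ h1 h2; simp at h2; linarith
  | succ r ih =>
    intro β hβ hsum hK hη0 hη hr
    set η := ∑ i ∈ Kᶜ, β i with hηdef
    set p : ℝ := 1 / M with hp
    have hM0 : (0 : ℝ) < M := by exact_mod_cast hM1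
    have hp0 : 0 < p := by positivity
    have hp1 : p ≤ 1 := by
      rw [hp, div_le_one hM0]; exact_mod_cast hM1
    have hs0 : (0 : ℝ) ≤ s := by positivity
    have hq : 1 < (2 : ℝ) ^ p := Real.one_lt_rpow (by norm_num) hp0
    have hC0 : 0 ≤ C := by
      by_contra hneg
      nlinarith
    set N := ⌊(1 / (4 * η)) ^ p⌋₊ with hNdef
    have hx1 : 1 ≤ (1 / (4 * η)) ^ p := by
      apply Real.one_le_rpow _ hp0.le
      rw [le_div_iff₀ (by positivity)]
      linarith
    have hN1 : 1 ≤ N := by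
      rw [hNdef]; exact Nat.le_floor (by exact_mod_cast hx1)
    have hN0 : (0 : ℝ) < N := by exact_mod_cast hN1
    have hNle : (N : ℝ) ≤ (1 / (4 * η)) ^ p := Nat.floor_le (by positivity)
    have hNge : (1 / (4 * η)) ^ p ≤ 2 * N := by
      have := Nat.lt_floor_add_one ((1 / (4 * η)) ^ p)
      have h1 : (1 : ℝ) ≤ N := by exact_mod_cast hN1
      linarith
    have hNinv : 1 / (N : ℝ) ≤ 8 * η ^ p := by
      have h1 : (1 / (4 * η)) ^ p * (4 * η) ^ p = 1 := by
        rw [← Real.mul_rpow (by positivity) (by positivity), one_div,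
          inv_mul_cancel₀ (by positivity), Real.one_rpow]
      have h2 : (4 * η) ^ p ≤ 4 * η ^ p := by
        rw [Real.mul_rpow (by norm_num) hη0.le]
        gcongr
        calc (4 : ℝ) ^ p ≤ 4 ^ (1 : ℝ) := Real.rpow_le_rpow_of_exponent_le (by norm_num) hp1
          _ = 4 := by norm_num
      rw [div_le_iff₀ hN0]
      have h3 : 0 < (4 * η) ^ p := by positivity
      nlinarith
    have hNpow : (N : ℝ) ^ M * η ≤ 1 / 4 := by
      have : (N : ℝ) ^ M ≤ 1 / (4 * η) := by
        calc (N : ℝ) ^ M ≤ ((1 / (4 * η)) ^ p) ^ M := by gcongr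
          _ = 1 / (4 * η) := by
            rw [← Real.rpow_natCast, ← Real.rpow_mul (by positivity), hp,
              one_div_mul_cancel hM0.ne', Real.rpow_one]
      calc (N : ℝ) ^ M * η ≤ 1 / (4 * η) * η := by gcongr
        _ = 1 / 4 := by field_simp
    have hηη₁ : η ^ p ≤ η₁ ^ p := Real.rpow_le_rpow hη0.le hη.le hp0.le
    have hMN : (M : ℝ) / N ≤ 1 / 4 := by
      calc (M : ℝ) / N = M * (1 / N) := by ring
        _ ≤ M * (8 * η₁ ^ p) := by gcongr; linarith
        _ = 8 * M * η₁ ^ p := by ring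
        _ ≤ 1 / 4 := hη₁M
    have hsN : (s : ℝ) / N ≤ 8 * s * η ^ p := by
      calc (s : ℝ) / N = s * (1 / N) := by ring
        _ ≤ s * (8 * η ^ p) := by gcongr
        _ = _ := by ring
    have hKδ : ∀ i ∈ K, δ₁ ≤ β i - s / N := by
      intro i hi
      have h1 := hK i hi
      have h2 : (C + 8 * s) * η ^ p ≤ (C + 8 * s) * η₁ ^ p := by gcongr
      linarith
    obtain ⟨β', hreach, hdrift, hdouble⟩ := CoeffReach.exists_step hs hM hN1 K hβ hsum hNpow hMN
      fun i hi => by linarith [hKδ i hi]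
    have hβ' : ∀ i, 0 ≤ β' i := by
      obtain ⟨_, _, _, _, h, _⟩ := hreach
      exact h
    by_cases hbig : η₁ ≤ ∑ i ∈ Kᶜ, β' i
    · exact ⟨β', hreach, fun i hi => (hKδ i hi).trans (hdrift i hi), hbig⟩
    · have hinv : ∀ i ∈ K, δ - C * (∑ i ∈ Kᶜ, β' i) ^ p ≤ β' i := by
        intro i hi
        have h1 := hK i hi
        have h2 := hdrift i hi
        have h3 : (2 : ℝ) ^ p * η ^ p ≤ (∑ i ∈ Kᶜ, β' i) ^ p := by
          rw [← Real.mul_rpow (by norm_num) hη0.le]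
          exact Real.rpow_le_rpow (by positivity) hdouble hp0.le
        have h4 : C * ((2 : ℝ) ^ p * η ^ p) ≤ C * (∑ i ∈ Kᶜ, β' i) ^ p := by gcongr
        have h5 : 8 * s * η ^ p ≤ C * ((2 : ℝ) ^ p - 1) * η ^ p := by gcongr
        linarith
      obtain ⟨γ, hγ, h1, h2⟩ := ih β' hβ' (hreach.sum_eq_one hsum) hinv
        (by linarith) (not_le.1 hbig) (by
          rw [pow_succ] at hr
          calc η₁ ≤ 2 ^ r * (2 * η) := by linarith
            _ ≤ _ := by gcongr)
      exact ⟨γ, hreach.trans hγ, h1, h2⟩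

theorem exists_large_coeffs_or_card_le (s M : ℕ) (hs : 1 ≤ s) (hM1 : 1 ≤ M) (j : ℕ) :
    ∃ δ : ℝ, 0 < δ ∧ ∀ (ι : Type) [Fintype ι], Fintype.card ι ≤ M → ∀ α : ι → ℝ,
      (∀ i, 0 ≤ α i) → ∑ i, α i = 1 → ∃ β, CoeffReach s α β ∧
        ((∀ i, 0 < β i → δ ≤ β i) ∨ ∃ K : Finset ι, j ≤ K.card ∧ ∀ i ∈ K, δ ≤ β i) := by
  induction j with
  | zero => exact ⟨1, one_pos, fun ι _ _ α hα _ => ⟨α, .refl s hα, .inr ⟨∅, by simp, by simp⟩⟩⟩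
  | succ j ih =>
    obtain ⟨δ, hδ, ih⟩ := ih
    have hM0 : (0 : ℝ) < M := by exact_mod_cast hM1
    have hp0 : (0 : ℝ) < 1 / M := by positivity
    have hq : 1 < (2 : ℝ) ^ (1 / M : ℝ) := Real.one_lt_rpow (by norm_num) hp0
    set C : ℝ := 8 * s / ((2 : ℝ) ^ (1 / M : ℝ) - 1) with hCdef
    have hC : 8 * s ≤ C * ((2 : ℝ) ^ (1 / M : ℝ) - 1) := by
      rw [hCdef, div_mul_cancel₀ _ (by linarith)]
    have hC0 : 0 ≤ C := div_nonneg (by positivity) (by linarith)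
    have hcont : Continuous fun x : ℝ => (M * x) ^ (1 / M : ℝ) :=
      (continuous_const.mul continuous_id).rpow_const fun _ => .inr hp0.le
    have hc0 : ((M : ℝ) * 0) ^ (1 / M : ℝ) = 0 := by
      rw [mul_zero, Real.zero_rpow hp0.ne']
    have ev1 : ∀ᶠ x : ℝ in nhdsWithin 0 (Ioi 0), 4 * (M * x) < 1 := by
      apply Filter.Eventually.filter_mono nhdsWithin_le_nhds
      exact (Continuous.tendsto (by fun_prop) _).eventually_lt_const (by simp)
    have ev2 : ∀ᶠ x : ℝ in nhdsWithin 0 (Ioi 0), 8 * M * (M * x) ^ (1 / M : ℝ) < 1 / 4 := by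
      apply Filter.Eventually.filter_mono nhdsWithin_le_nhds
      exact (Continuous.tendsto (continuous_const.mul hcont) _).eventually_lt_const
        (by change 8 * (M : ℝ) * (M * 0) ^ (1 / M : ℝ) < 1 / 4; rw [hc0]; norm_num)
    have ev3 : ∀ᶠ x : ℝ in nhdsWithin 0 (Ioi 0),
        x + (C + 8 * s) * (M * x) ^ (1 / M : ℝ) < δ := by
      apply Filter.Eventually.filter_mono nhdsWithin_le_nhds
      exact (Continuous.tendsto (continuous_id.add (continuous_const.mul hcont)) _
        ).eventually_lt_const (by
          change 0 + (C + 8 * s) * ((M : ℝ) * 0) ^ (1 / M : ℝ) < δ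
          rw [hc0]; simpa using hδ)
    obtain ⟨δ₁, ⟨⟨h1, h2⟩, h3⟩, hδ₁⟩ :=
      (((ev1.and ev2).and ev3).and self_mem_nhdsWithin).exists
    have hδ₁ : 0 < δ₁ := hδ₁
    have hδδ : δ₁ ≤ δ := by
      have : 0 ≤ (C + 8 * s) * (M * δ₁) ^ (1 / M : ℝ) := by positivity
      linarith
    refine ⟨δ₁, hδ₁, fun ι _ hcard α hα hsum => ?_⟩
    classical
    obtain ⟨β, hreach, hβ | ⟨K, hKj, hK⟩⟩ := ih ι hcard α hα hsum
    · exact ⟨β, hreach, .inl fun i hi => hδδ.trans (hβ i hi)⟩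
    have hβ0 : ∀ i, 0 ≤ β i := by
      obtain ⟨_, _, _, _, h, _⟩ := hreach
      exact h
    have hβs := hreach.sum_eq_one hsum
    suffices h : (∑ i ∈ Kᶜ, β i = 0) ∨ ∃ β', CoeffReach s β β' ∧ (∀ i ∈ K, δ₁ ≤ β' i) ∧
        M * δ₁ ≤ ∑ i ∈ Kᶜ, β' i by
      rcases h with h | ⟨β', hr, hK', hbig⟩
      · refine ⟨β, hreach, .inl fun i hi => ?_⟩
        by_cases hiK : i ∈ K
        · exact hδδ.trans (hK i hiK)
        · rw [Finset.sum_eq_zero_iff_of_nonneg fun i _ => hβ0 i] at h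
          rw [h i (Finset.mem_compl.2 hiK)] at hi
          exact absurd hi (lt_irrefl _)
      · refine ⟨β', hreach.trans hr, .inr ?_⟩
        obtain ⟨i, hi, hiδ⟩ : ∃ i ∈ Kᶜ, δ₁ ≤ β' i := by
          by_contra! hlt
          have hne : (Kᶜ).Nonempty := by
            rw [Finset.nonempty_iff_ne_empty]
            rintro he
            rw [he, Finset.sum_empty] at hbig
            have : 0 < M * δ₁ := by positivity
            linarith
          have h1 := Finset.sum_lt_sum_of_nonempty hne hlt
          have h2 : ((Kᶜ).card : ℝ) ≤ M := by
            exact_mod_cast (Finset.card_le_univ _).trans hcard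
          rw [Finset.sum_const, nsmul_eq_mul] at h1
          nlinarith
        have hiK := Finset.mem_compl.1 hi
        refine ⟨insert i K, by rw [Finset.card_insert_of_notMem hiK]; omega, ?_⟩
        intro k hk
        rcases Finset.mem_insert.1 hk with rfl | hk
        · exact hiδ
        · exact hK' k hk
    rcases (Finset.sum_nonneg fun i _ => hβ0 i : 0 ≤ ∑ i ∈ Kᶜ, β i).eq_or_lt with h0 | h0
    · exact .inl h0.symm
    right
    by_cases hbig : M * δ₁ ≤ ∑ i ∈ Kᶜ, β i
    · exact ⟨β, .refl s hβ0, fun i hi => hδδ.trans (hK i hi), hbig⟩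
    obtain ⟨r, hr⟩ := pow_unbounded_of_one_lt (M * δ₁ / ∑ i ∈ Kᶜ, β i) one_lt_two
    refine CoeffReach.exists_large hs hcard hM1 K hδ₁ hC h1.le h2.le h3.le r β hβ0 hβs
      (fun i hi => ?_) h0 (not_le.1 hbig) ?_
    · have : 0 ≤ C * (∑ i ∈ Kᶜ, β i) ^ (1 / M : ℝ) := by positivity
      linarith [hK i hi]
    · rw [div_lt_iff₀ h0] at hr
      exact hr.le

/-- Positive coefficients of a convex combination of boundedly many points can be made uniformly
positive by integral affine operations modulo `s`. -/
theorem exists_uniform_coeffs (s M : ℕ) (hs : 1 ≤ s) :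
    ∃ δ : ℝ, 0 < δ ∧ ∀ (ι : Type) [Fintype ι], Fintype.card ι ≤ M → ∀ α : ι → ℝ,
      (∀ i, 0 ≤ α i) → ∑ i, α i = 1 →
      ∃ β, CoeffReach s α β ∧ ∀ i, 0 < β i → δ ≤ β i := by
  obtain ⟨δ, hδ, h⟩ := exists_large_coeffs_or_card_le s (M + 1) hs (by omega) (M + 1)
  refine ⟨δ, hδ, fun ι _ hcard α hα hsum => ?_⟩
  obtain ⟨β, hr, hβ | ⟨K, hK, -⟩⟩ := h ι (by omega) α hα hsum
  · exact ⟨β, hr, hβ⟩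
  · have := Finset.card_le_univ K
    omega

section Polyhedra

variable {d : ℕ}

theorem isPolyhedron_of_fintype {κ : Type*} [Fintype κ] (A : κ → Fin d → ℝ) (b : κ → ℝ) :
    IsPolyhedron {x : Fin d → ℝ | ∀ k, ∑ j, A k j * x j ≤ b k} := by
  let e := Fintype.equivFin κ
  refine ⟨Fintype.card κ, fun i => A (e.symm i), fun i => b (e.symm i), ?_⟩
  ext x
  exact ⟨fun h i => h _, fun h k => by simpa using h (e k)⟩

theorem exists_forall_mul_le_iff {κ : Type*} [Fintype κ] (c r : κ → ℝ) :
    (∃ t : ℝ, ∀ k, c k * t ≤ r k) ↔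
      (∀ k, c k = 0 → 0 ≤ r k) ∧ ∀ k l, 0 < c k → c l < 0 → 0 ≤ c k * r l - c l * r k := by
  classical
  constructor
  · rintro ⟨t, ht⟩
    refine ⟨fun k hk => by simpa [hk] using ht k, fun k l hk hl => ?_⟩
    nlinarith [mul_le_mul_of_nonneg_left (ht l) hk.le,
      mul_le_mul_of_nonneg_left (ht k) (neg_nonneg.2 hl.le)]
  · rintro ⟨h0, h1⟩
    suffices h : ∃ t : ℝ, (∀ k, 0 < c k → t ≤ r k / c k) ∧ ∀ l, c l < 0 → r l / c l ≤ t by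
      obtain ⟨t, hu, hl⟩ := h
      refine ⟨t, fun k => ?_⟩
      rcases lt_trichotomy (c k) 0 with hk | hk | hk
      · have := hl k hk
        rw [div_le_iff_of_neg hk] at this
        linarith
      · simpa [hk] using h0 k hk
      · have := hu k hk
        rw [le_div_iff₀ hk] at this
        linarith
    have hlu : ∀ k l, 0 < c k → c l < 0 → r l / c l ≤ r k / c k := by
      intro k l hk hl
      rw [div_le_iff_of_neg hl, div_mul_eq_mul_div, div_le_iff₀ hk]
      linarith [h1 k l hk hl]
    by_cases hne : (Finset.univ.filter fun l => c l < 0).Nonempty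
    · obtain ⟨l, hl, hmax⟩ := Finset.exists_max_image _ (fun l => r l / c l) hne
      exact ⟨r l / c l, fun k hk => hlu k l hk (by simpa using hl),
        fun k hk => hmax k (by simpa using hk)⟩
    by_cases hne' : (Finset.univ.filter fun l => 0 < c l).Nonempty
    · obtain ⟨l, hl, hmin⟩ := Finset.exists_min_image _ (fun l => r l / c l) hne'
      refine ⟨r l / c l, fun k hk => hmin k (by simpa using hk), fun k hk => ?_⟩
      exact absurd ⟨k, by simpa using hk⟩ hne
    · exact ⟨0, fun k hk => absurd ⟨k, by simpa using hk⟩ hne',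
        fun k hk => absurd ⟨k, by simpa using hk⟩ hne⟩

/-- Fourier–Motzkin elimination of one variable. -/
theorem isPolyhedron_exists {κ : Type*} [Fintype κ] (A : κ → Fin d → ℝ) (c b : κ → ℝ) :
    IsPolyhedron {x : Fin d → ℝ | ∃ t : ℝ, ∀ k, ∑ j, A k j * x j + c k * t ≤ b k} := by
  classical
  convert isPolyhedron_of_fintype (κ := {k // c k = 0} ⊕ {q : κ × κ // 0 < c q.1 ∧ c q.2 < 0})
    (Sum.elim (fun k => A k) fun q => c q.1.1 • A q.1.2 - c q.1.2 • A q.1.1)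
    (Sum.elim (fun k => b k) fun q => c q.1.1 * b q.1.2 - c q.1.2 * b q.1.1) using 1
  ext x
  have h1 : (∃ t : ℝ, ∀ k, ∑ j, A k j * x j + c k * t ≤ b k) ↔
      ∃ t : ℝ, ∀ k, c k * t ≤ b k - ∑ j, A k j * x j := by
    simp only [le_sub_iff_add_le']
  have h2 : ∀ k l, ∑ j, (c k • A l - c l • A k) j * x j
      = c k * ∑ j, A l j * x j - c l * ∑ j, A k j * x j := by
    intro k l
    simp only [Pi.sub_apply, Pi.smul_apply, smul_eq_mul, sub_mul, Finset.sum_sub_distrib,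
      Finset.mul_sum, mul_assoc]
  simp only [mem_ofPred_eq, h1, exists_forall_mul_le_iff, Sum.forall, Subtype.forall, Prod.forall,
    Sum.elim_inl, Sum.elim_inr, h2, and_imp, sub_nonneg]
  refine and_congr_right fun _ => forall_congr' fun k => forall_congr' fun l =>
    imp_congr_right fun _ => imp_congr_right fun _ => ?_
  constructor <;> intro h <;> linarith

/-- The union of the translates `P + t • u` with `t ∈ I`. -/
def sweep (I : Set ℝ) (u : Fin d → ℝ) (P : Set (Fin d → ℝ)) : Set (Fin d → ℝ) :=
  {x | ∃ t ∈ I, x - t • u ∈ P}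

theorem add_smul_mem_sweep {I : Set ℝ} {u p : Fin d → ℝ} {P : Set (Fin d → ℝ)} {t : ℝ}
    (ht : t ∈ I) (hp : p ∈ P) : p + t • u ∈ sweep I u P :=
  ⟨t, ht, by simpa using hp⟩

theorem subset_sweep {I : Set ℝ} (hI : 0 ∈ I) (u : Fin d → ℝ) (P : Set (Fin d → ℝ)) :
    P ⊆ sweep I u P := fun p hp => by simpa using add_smul_mem_sweep hI hp

theorem convex_sweep {I : Set ℝ} (hI : Convex ℝ I) (u : Fin d → ℝ) {P : Set (Fin d → ℝ)}
    (hP : Convex ℝ P) : Convex ℝ (sweep I u P) := by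
  rintro x ⟨t, ht, hx⟩ y ⟨t', ht', hy⟩ a b ha hb hab
  refine ⟨a * t + b * t', hI ht ht' ha hb hab, ?_⟩
  convert hP hx hy ha hb hab using 1
  module

theorem IsPolyhedron.isPolyhedron_sweep {P : Set (Fin d → ℝ)} (hP : IsPolyhedron P) {I : Set ℝ}
    {n : ℕ} {a r : Fin n → ℝ} (hI : I = {t | ∀ k, a k * t ≤ r k}) (u : Fin d → ℝ) :
    IsPolyhedron (sweep I u P) := by
  obtain ⟨m, A, b, rfl⟩ := hP
  convert isPolyhedron_exists (κ := Fin n ⊕ Fin m) (Sum.elim (fun _ => 0) A)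
    (Sum.elim a fun k => -∑ j, A k j * u j) (Sum.elim r b) using 1
  ext x
  simp only [sweep, hI, mem_ofPred_eq, Sum.forall, Sum.elim_inl, Sum.elim_inr,
    Pi.zero_apply, zero_mul, Finset.sum_const_zero, zero_add, Pi.sub_apply, Pi.smul_apply,
    smul_eq_mul]
  refine exists_congr fun t => and_congr_right fun _ => forall_congr' fun k => ?_
  have : ∑ j, A k j * (x j - t * u j) = ∑ j, A k j * x j + -(∑ j, A k j * u j) * t := by
    rw [Finset.sum_congr rfl fun j _ => mul_sub (A k j) (x j) (t * u j), Finset.sum_sub_distrib,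
      neg_mul, ← sub_eq_add_neg, Finset.sum_mul]
    exact congrArg _ (Finset.sum_congr rfl fun j _ => by ring)
  rw [this]

theorem IsPolyhedron.isPolyhedron_sweep_univ {P : Set (Fin d → ℝ)} (hP : IsPolyhedron P)
    (u : Fin d → ℝ) :
    IsPolyhedron (sweep univ u P) :=
  hP.isPolyhedron_sweep (n := 0) (a := 0) (r := 0) (by ext; simp) u

theorem IsPolyhedron.isPolyhedron_sweep_Icc {P : Set (Fin d → ℝ)} (hP : IsPolyhedron P)
    (u : Fin d → ℝ) :
    IsPolyhedron (sweep (Icc 0 1) u P) :=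
  hP.isPolyhedron_sweep (a := ![-1, 1]) (r := ![0, 1]) (by ext; simp [Fin.forall_fin_two]) u

/-- The real vector with the given integer coordinates. -/
def intVec (z : Fin d → ℤ) : Fin d → ℝ := fun i => (z i : ℝ)

@[simp] theorem intVec_apply (z : Fin d → ℤ) (i : Fin d) : intVec z i = z i := rfl

theorem mem_intPts {x : Fin d → ℝ} : x ∈ intPts d ↔ ∃ z, intVec z = x :=
  ⟨fun h => ⟨fun i => (h i).choose, funext fun i => (h i).choose_spec.symm⟩,
    fun ⟨z, hz⟩ i => ⟨z i, by rw [← hz, intVec_apply]⟩⟩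

theorem intVec_mem_intPts (z : Fin d → ℤ) : intVec z ∈ intPts d := mem_intPts.2 ⟨z, rfl⟩

@[simp] theorem intVec_zero : intVec (0 : Fin d → ℤ) = 0 := by ext; simp

@[simp] theorem intVec_add (a b : Fin d → ℤ) : intVec (a + b) = intVec a + intVec b := by
  ext; simp

@[simp] theorem intVec_sub (a b : Fin d → ℤ) : intVec (a - b) = intVec a - intVec b := by
  ext; simp

@[simp] theorem intVec_smul (n : ℤ) (a : Fin d → ℤ) : intVec (n • a) = (n : ℝ) • intVec a := by
  ext; simp

@[simp] theorem intVec_sum {κ : Type*} (t : Finset κ) (f : κ → Fin d → ℤ) :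
    intVec (∑ k ∈ t, f k) = ∑ k ∈ t, intVec (f k) := by
  ext; simp [Finset.sum_apply]

theorem mem_sLat {s : ℕ} {x : Fin d → ℝ} : x ∈ sLat d s ↔ ∃ z, intVec ((s : ℤ) • z) = x := by
  constructor
  · intro h
    exact ⟨fun i => (h i).choose, funext fun i => by simpa using (h i).choose_spec.symm⟩
  · rintro ⟨z, rfl⟩ i
    exact ⟨z i, by simp⟩

theorem IsIntegralPoly.convex {P : Set (Fin d → ℝ)} (hP : IsIntegralPoly P) : Convex ℝ P := by
  rw [hP]; exact convex_convexHull ℝ _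

theorem IsIntegralPoly.subset_of_convex {P Q : Set (Fin d → ℝ)} (hP : IsIntegralPoly P)
    (hQ : Convex ℝ Q) (h : ∀ z, intVec z ∈ P → intVec z ∈ Q) : P ⊆ Q := by
  have h1 : P ∩ intPts d ⊆ Q := by
    rintro x ⟨hx, hz⟩
    obtain ⟨z, rfl⟩ := mem_intPts.1 hz
    exact h z hx
  have h2 := convexHull_min h1 hQ
  rwa [← hP] at h2

theorem IsIntegralPoly.isIntegralPoly_sweep {P : Set (Fin d → ℝ)} (hP : IsIntegralPoly P)
    {I : Set ℝ}
    (hI : Convex ℝ I) (hI' : ∀ t ∈ I, ∃ a b : ℤ, (a : ℝ) ∈ I ∧ (b : ℝ) ∈ I ∧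
      t ∈ segment ℝ (a : ℝ) b) (u : Fin d → ℤ) :
    IsIntegralPoly (sweep I (intVec u) P) := by
  refine subset_antisymm ?_ (convexHull_min inter_subset_left (convex_sweep hI _ hP.convex))
  set Q := convexHull ℝ (sweep I (intVec u) P ∩ intPts d) with hQ
  have hQc : Convex ℝ Q := convex_convexHull ℝ _
  have key : P ⊆ {p | ∀ t ∈ I, p + t • intVec u ∈ Q} := by
    refine hP.subset_of_convex ?_ ?_
    · intro x hx y hy a b ha hb hab t ht
      convert hQc (hx t ht) (hy t ht) ha hb hab using 1
      obtain rfl : b = 1 - a := by linarith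
      module
    · intro z hz t ht
      obtain ⟨a, b, ha, hb, p, q, hp, hq, hpq, rfl⟩ := hI' t ht
      have hmem : ∀ c : ℤ, (c : ℝ) ∈ I → intVec z + (c : ℝ) • intVec u ∈ Q := fun c hc =>
        subset_convexHull ℝ _ ⟨add_smul_mem_sweep hc hz, by
          rw [← intVec_smul, ← intVec_add]
          exact intVec_mem_intPts _⟩
      convert hQc (hmem a ha) (hmem b hb) hp hq hpq using 1
      obtain rfl : q = 1 - p := by linarith
      simp only [smul_eq_mul]
      module
  rintro x ⟨t, ht, hx⟩
  simpa using key hx t ht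

theorem IsIntegralPoly.isIntegralPoly_sweep_univ {P : Set (Fin d → ℝ)} (hP : IsIntegralPoly P)
    (u : Fin d → ℤ) : IsIntegralPoly (sweep univ (intVec u) P) := by
  refine hP.isIntegralPoly_sweep convex_univ (fun t _ => ⟨⌊t⌋, ⌊t⌋ + 1, trivial, trivial, ?_⟩) u
  rw [segment_eq_Icc (by push_cast; linarith)]
  exact ⟨Int.floor_le t, by push_cast; exact (Int.lt_floor_add_one t).le⟩

theorem IsIntegralPoly.isIntegralPoly_sweep_Icc {P : Set (Fin d → ℝ)} (hP : IsIntegralPoly P)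
    (u : Fin d → ℤ) : IsIntegralPoly (sweep (Icc 0 1) (intVec u) P) := by
  refine hP.isIntegralPoly_sweep (convex_Icc 0 1) (fun t ht => ⟨0, 1, by simp, by simp, ?_⟩) u
  rw [segment_eq_Icc (by simp)]
  simpa using ht

end Polyhedra

section Maximality

variable {d s : ℕ} {P : Set (Fin d → ℝ)}

/-- The integer vectors spanning lines along which `P` is invariant. -/
def intLineality (P : Set (Fin d → ℝ)) : Submodule ℤ (Fin d → ℤ) where
  carrier := {u | ∀ p ∈ P, ∀ t : ℝ, p + t • intVec u ∈ P}
  add_mem' {a b} ha hb p hp t := by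
    rw [intVec_add, smul_add, ← add_assoc]
    exact hb _ (ha p hp t) t
  zero_mem' p hp t := by simpa using hp
  smul_mem' n a ha p hp t := by
    rw [intVec_smul, smul_smul]
    exact ha p hp _

theorem mem_intLineality {u : Fin d → ℤ} :
    u ∈ intLineality P ↔ ∀ p ∈ P, ∀ t : ℝ, p + t • intVec u ∈ P := Iff.rfl

theorem MemPifm.exists_mem_interior_sweep (hP : MemPifm d s P) {u : Fin d → ℤ}
    (hu : u ∉ intLineality P) : ∃ y ∈ sLat d s, y ∈ interior (sweep univ (intVec u) P) := by
  by_contra! h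
  have hQ : IsIntLatFree d s (sweep univ (intVec u) P) :=
    ⟨hP.1.1.isPolyhedron_sweep_univ _, hP.1.2.1.isIntegralPoly_sweep_univ _,
      eq_empty_iff_forall_notMem.2 fun y hy => h y hy.2 hy.1⟩
  refine hu fun p hp t => ?_
  rw [hP.2 _ hQ (subset_sweep (mem_univ _) _ _)]
  exact add_smul_mem_sweep (mem_univ _) hp

/-- A maximal integral lattice-free polyhedron is not contained in a hyperplane. -/
theorem MemPifm.eq_zero_of_forall_dotProduct (hP : MemPifm d s P) {w : Fin d → ℤ}
    (hw : intVec w ∈ P) {a : Fin d → ℤ} (ha : ∀ z, intVec z ∈ P → a ⬝ᵥ (z - w) = 0) :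
    a = 0 := by
  by_contra ha0
  have hex : ∃ n : ℕ, 0 < n ∧ ∃ z : Fin d → ℤ, a ⬝ᵥ z = n := by
    have hpos : 0 < a ⬝ᵥ a := lt_of_le_of_ne
      (Finset.sum_nonneg fun i _ => mul_self_nonneg _)
      fun h => ha0 (dotProduct_self_eq_zero.1 h.symm)
    exact ⟨(a ⬝ᵥ a).toNat, by omega, a, by omega⟩
  classical
  obtain ⟨hg0, z, hz⟩ := Nat.find_spec hex
  have hmin : ∀ m : ℕ, m < Nat.find hex → ¬ (0 < m ∧ ∃ z : Fin d → ℤ, a ⬝ᵥ z = m) :=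
    fun m hm => Nat.find_min hex hm
  generalize Nat.find hex = g at hg0 hz hmin
  have hg0' : (0 : ℝ) < g := by exact_mod_cast hg0
  have hcast : ∀ v : Fin d → ℤ, intVec a ⬝ᵥ intVec v = ((a ⬝ᵥ v : ℤ) : ℝ) := by
    intro v
    simp [dotProduct]
  have hF : ∀ p ∈ P, intVec a ⬝ᵥ (p - intVec w) = 0 := by
    refine hP.1.2.1.subset_of_convex (Q := {p | intVec a ⬝ᵥ (p - intVec w) = 0}) ?_ ?_
    · intro x hx y hy b c _ _ hbc
      have : b • x + c • y - intVec w = b • (x - intVec w) + c • (y - intVec w) := by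
        obtain rfl : c = 1 - b := by linarith
        module
      simp only [mem_ofPred_eq] at hx hy ⊢
      rw [this, dotProduct_add, dotProduct_smul, dotProduct_smul, hx, hy]
      simp
    · intro v hv
      simp only [mem_ofPred_eq]
      rw [← intVec_sub, hcast, ha v hv, Int.cast_zero]
  have hFQ : ∀ x ∈ sweep (Icc 0 1) (intVec z) P, 0 ≤ intVec a ⬝ᵥ (x - intVec w) ∧
      intVec a ⬝ᵥ (x - intVec w) ≤ g := by
    rintro x ⟨t, ht, hx⟩
    have h1 := hF _ hx
    have h2 : x - intVec w = (x - t • intVec z - intVec w) + t • intVec z := by module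
    rw [h2, dotProduct_add, h1, dotProduct_smul, hcast, hz, zero_add]
    simp only [smul_eq_mul, Int.cast_natCast]
    constructor
    · have := ht.1; positivity
    · nlinarith [ht.2]
  have hQ : IsIntLatFree d s (sweep (Icc 0 1) (intVec z) P) := by
    refine ⟨hP.1.1.isPolyhedron_sweep_Icc _, hP.1.2.1.isIntegralPoly_sweep_Icc _,
      eq_empty_iff_forall_notMem.2 ?_⟩
    rintro x ⟨hx, hxs⟩
    obtain ⟨v, rfl⟩ := mem_sLat.1 hxs
    generalize (s : ℤ) • v = v at hx
    have hcont : ContinuousAt (fun ε : ℝ => intVec v + ε • intVec z) 0 := by fun_prop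
    have hmem : ∀ᶠ ε : ℝ in nhds 0,
        intVec v + ε • intVec z ∈ sweep (Icc 0 1) (intVec z) P := by
      refine hcont.eventually_mem ?_
      simpa using mem_interior_iff_mem_nhds.1 hx
    obtain ⟨ε, hε, hε'⟩ := Metric.eventually_nhds_iff.1 hmem
    have h1 := (hFQ _ (hε' (y := ε / 2) (by
      rw [dist_zero_right, Real.norm_eq_abs, abs_of_pos (by positivity)]; linarith))).2
    have h2 := (hFQ _ (hε' (y := -(ε / 2)) (by
      rw [dist_zero_right, Real.norm_eq_abs, abs_neg, abs_of_pos (by positivity)]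
      linarith))).1
    have h3 : ∀ c : ℝ, intVec a ⬝ᵥ (intVec v + c • intVec z - intVec w)
        = ((a ⬝ᵥ (v - w) : ℤ) : ℝ) + c * g := by
      intro c
      rw [add_sub_right_comm, dotProduct_add, dotProduct_smul, ← intVec_sub, hcast, hcast, hz]
      simp
    rw [h3] at h1 h2
    have h4 : (0 : ℝ) < ((a ⬝ᵥ (v - w) : ℤ) : ℝ) := by nlinarith
    have h5 : ((a ⬝ᵥ (v - w) : ℤ) : ℝ) < (g : ℤ) := by push_cast; nlinarith
    have h4' : 0 < a ⬝ᵥ (v - w) := by exact_mod_cast h4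
    have h5' : a ⬝ᵥ (v - w) < g := by exact_mod_cast h5
    exact hmin (a ⬝ᵥ (v - w)).toNat (by omega) ⟨by omega, v - w, by omega⟩
  have hmem : intVec w + (1 : ℝ) • intVec z ∈ P := by
    rw [hP.2 _ hQ (subset_sweep (by simp) _ _)]
    exact add_smul_mem_sweep (by simp) hw
  have := hF _ hmem
  rw [one_smul, add_sub_cancel_left, hcast, hz] at this
  simp only [Int.cast_natCast] at this
  linarith

theorem exists_linear_coords {e : Matrix (Fin d) (Fin d) ℤ} (he : e.det ≠ 0) :
    ∃ T : (Fin d → ℝ) →ₗ[ℝ] (Fin d → ℝ), ∀ x, x = ∑ i, T x i • intVec (e i) := by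
  let eR : Matrix (Fin d) (Fin d) ℝ := e.map (Int.castRingHom ℝ)
  have hdet : IsUnit eR.det := by
    have h1 : eR.det = (e.det : ℝ) := (RingHom.map_det (Int.castRingHom ℝ) e).symm
    rw [h1, isUnit_iff_ne_zero]
    exact_mod_cast he
  refine ⟨Matrix.vecMulLinear eR⁻¹, fun x => ?_⟩
  have h2 : Matrix.vecMul (Matrix.vecMulLinear eR⁻¹ x) eR = x := by
    rw [Matrix.vecMulLinear_apply, Matrix.vecMul_vecMul, Matrix.nonsing_inv_mul _ hdet,
      Matrix.vecMul_one]
  conv_lhs => rw [← h2]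
  rw [Matrix.vecMul_eq_sum]
  rfl

theorem mem_interior_of_pos_coeffs (hP : Convex ℝ P) {w : Fin d → ℝ}
    {e : Matrix (Fin d) (Fin d) ℤ} (he : e.det ≠ 0) (hw : w ∈ P)
    (hwe : ∀ i, w + intVec (e i) ∈ P) {ι : Type*} [Fintype ι] {v : ι → Fin d → ℝ}
    (hv : ∀ k, v k ∈ P) {a : ℝ} {b : Fin d → ℝ} {c : ι → ℝ} (ha : 0 < a) (hb : ∀ i, 0 < b i)
    (hc : ∀ k, 0 ≤ c k) (hsum : a + ∑ i, b i + ∑ k, c k = 1) :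
    a • w + ∑ i, b i • (w + intVec (e i)) + ∑ k, c k • v k ∈ interior P := by
  obtain ⟨T, hT⟩ := exists_linear_coords he
  have hTc : Continuous T := T.continuous_of_finiteDimensional
  set x := a • w + ∑ i, b i • (w + intVec (e i)) + ∑ k, c k • v k with hx
  rw [mem_interior_iff_mem_nhds]
  have h1 : ∀ᶠ y in nhds x, ∀ i, 0 < b i + T (y - x) i := by
    rw [Filter.eventually_all]
    intro i
    have : Continuous fun y => b i + T (y - x) i := by fun_prop
    exact (this.tendsto x).eventually_const_lt (by simpa using hb i)
  have h2 : ∀ᶠ y in nhds x, 0 < a - ∑ i, T (y - x) i := by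
    have : Continuous fun y => a - ∑ i, T (y - x) i := by fun_prop
    exact (this.tendsto x).eventually_const_lt (by simpa using ha)
  filter_upwards [h1, h2] with y hy1 hy2
  have key := hP.sum_mem (t := (Finset.univ : Finset (Option (Fin d) ⊕ ι)))
    (w := Sum.elim (fun o => o.elim (a - ∑ i, T (y - x) i) fun i => b i + T (y - x) i) c)
    (z := Sum.elim (fun o => o.elim w fun i => w + intVec (e i)) v) ?_ ?_ ?_
  · convert key using 1
    rw [Fintype.sum_sum_type, Fintype.sum_option]
    simp only [Sum.elim_inl, Sum.elim_inr, Option.elim]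
    have h3 : y = x + ∑ i, T (y - x) i • intVec (e i) := by rw [← hT (y - x)]; abel
    generalize T (y - x) = τ at h3
    conv_lhs => rw [h3, hx]
    simp only [add_smul, sub_smul, smul_add, Finset.sum_add_distrib, Finset.sum_smul]
    abel
  · rintro ((_ | i) | k) -
    · exact hy2.le
    · exact (hy1 i).le
    · exact hc k
  · rw [Fintype.sum_sum_type, Fintype.sum_option]
    simp only [Sum.elim_inl, Sum.elim_inr, Option.elim, Finset.sum_add_distrib]
    linarith
  · rintro ((_ | i) | k) -
    · exact hw
    · exact hwe i
    · exact hv k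

end Maximality

section Frames

variable {d s : ℕ} {P : Set (Fin d → ℝ)}

/-- Every point of an integral polyhedron is a convex combination of at most `d + 1` of its
integer points. -/
theorem IsIntegralPoly.exists_convex_combination (hP : IsIntegralPoly P) {p : Fin d → ℝ}
    (hp : p ∈ P) : ∃ (ι : Type) (_ : Fintype ι) (z : ι → Fin d → ℤ) (c : ι → ℝ),
      Fintype.card ι ≤ d + 1 ∧ (∀ k, intVec (z k) ∈ P) ∧ (∀ k, 0 < c k) ∧ ∑ k, c k = 1 ∧
        ∑ k, c k • intVec (z k) = p := by
  rw [hP] at hp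
  obtain ⟨ι, hι, v, c, hv, hind, hc, hsum, hcomb⟩ := eq_pos_convex_span_of_mem_convexHull hp
  have hv' : ∀ k, v k ∈ P ∩ intPts d := fun k => hv (mem_range_self k)
  choose z hz using fun k => mem_intPts.1 (hv' k).2
  refine ⟨ι, hι, z, c, ?_, fun k => by rw [hz]; exact (hv' k).1, hc, hsum, by simpa only [hz]⟩
  refine hind.card_le_finrank_succ.trans (Nat.succ_le_succ ?_)
  exact (Submodule.finrank_le _).trans (by simp)

/-- An interior point of `P + ℝ u` is, up to a multiple of `u`, a convex combination of integer
points of `P` and of prescribed vectors `W o`, all with positive coefficients. -/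
theorem IsIntegralPoly.exists_combination_of_mem_interior_sweep (hP : IsIntegralPoly P)
    {u : Fin d → ℤ} {W : Option (Fin d) → Fin d → ℤ}
    {y : Fin d → ℝ} (hy : y ∈ interior (sweep univ (intVec u) P)) :
    ∃ (ι : Type) (_ : Fintype ι) (z : ι → Fin d → ℤ) (α : Option (Fin d) ⊕ ι → ℝ) (θ : ℝ),
      Fintype.card ι ≤ d + 1 ∧ (∀ k, intVec (z k) ∈ P) ∧ (∀ k, 0 < α k) ∧ ∑ k, α k = 1 ∧
        y = ∑ k, α k • intVec (Sum.elim W z k) + θ • intVec u := by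
  set c : Fin d → ℝ := ∑ o, (1 / (d + 1) : ℝ) • intVec (W o) with hc
  have hd0 : (0 : ℝ) < d + 1 := by positivity
  have hcont : ContinuousAt (fun ε : ℝ => y + ε • (y - c)) 0 := by fun_prop
  have hmem : ∀ᶠ ε : ℝ in nhds 0, y + ε • (y - c) ∈ sweep univ (intVec u) P := by
    refine hcont.eventually_mem ?_
    simpa using mem_interior_iff_mem_nhds.1 hy
  obtain ⟨ε, ⟨t, -, hp⟩, hε⟩ :=
    ((hmem.filter_mono (nhdsWithin_le_nhds (s := Ioi 0))).and self_mem_nhdsWithin).exists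
  have hε : 0 < ε := hε
  obtain ⟨ι, hι, z, a, hcard, hz, ha, hasum, hcomb⟩ := hP.exists_convex_combination hp
  refine ⟨ι, hι, z, Sum.elim (fun _ => ε / (1 + ε) * (1 / (d + 1))) fun k => 1 / (1 + ε) * a k,
    1 / (1 + ε) * t, hcard, hz, ?_, ?_, ?_⟩
  · rintro (o | k)
    · simp only [Sum.elim_inl]; positivity
    · have := ha k
      simp only [Sum.elim_inr]; positivity
  · rw [Fintype.sum_sum_type]
    simp only [Sum.elim_inl, Sum.elim_inr, ← Finset.mul_sum, hasum, Finset.sum_const,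
      Finset.card_univ, Fintype.card_option, Fintype.card_fin, nsmul_eq_mul]
    push_cast
    field_simp
    ring
  · rw [Fintype.sum_sum_type]
    simp only [Sum.elim_inl, Sum.elim_inr, mul_smul, ← Finset.smul_sum, hcomb]
    rw [Finset.smul_sum, ← hc]
    have h1 : (1 + ε) • y = ε • c + (y + ε • (y - c) - t • intVec u) + t • intVec u := by module
    have h2 : y = (1 / (1 + ε)) • (1 + ε) • y := by
      rw [smul_smul, one_div_mul_cancel (by positivity), one_smul]
    conv_lhs => rw [h2, h1]
    have h3 : ε / (1 + ε) = 1 / (1 + ε) * ε := by ring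
    rw [h3]
    module

/-- Integer vectors with small coordinates in a full-dimensional integral simplex of a maximal
integral lattice-free polyhedron are directions of invariance. -/
theorem exists_small_coords_mem_intLineality (d s : ℕ) (hs : 1 ≤ s) :
    ∃ N : ℕ, 1 ≤ N ∧ ∀ P : Set (Fin d → ℝ), MemPifm d s P →
      ∀ (w : Fin d → ℤ) (e : Matrix (Fin d) (Fin d) ℤ), intVec w ∈ P →
        (∀ i, intVec (w + e i) ∈ P) → e.det ≠ 0 → ∀ (u : Fin d → ℤ) (τ : Fin d → ℝ),
          intVec u = ∑ i, τ i • intVec (e i) → (∀ i, |τ i| ≤ 1 / N) → u ∈ intLineality P := by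
  obtain ⟨δ, hδ, hcoef⟩ := exists_uniform_coeffs s (2 * d + 2) hs
  have hs0 : (0 : ℝ) < s := by exact_mod_cast hs
  obtain ⟨N, hN⟩ := exists_nat_gt (s * (d + 1) / δ)
  have hN0 : (0 : ℝ) < N := lt_of_le_of_lt (by positivity) hN
  have hNδ : s * (d + 1) / N < δ := by
    rw [div_lt_iff₀ hδ] at hN
    rw [div_lt_iff₀ hN0]
    linarith
  refine ⟨N, by exact_mod_cast hN0, fun P hP w e hw hwe he u τ hu hτ => ?_⟩
  by_contra hlin
  obtain ⟨y, hyΛ, hy⟩ := hP.exists_mem_interior_sweep hlin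
  let W : Option (Fin d) → Fin d → ℤ := fun o => o.elim w fun i => w + e i
  obtain ⟨ι, hι, z, α, θ, hcard, hz, hα, hαsum, hyeq⟩ :=
    hP.1.2.1.exists_combination_of_mem_interior_sweep (W := W) hy
  obtain ⟨β, hreach, hβδ⟩ := hcoef (Option (Fin d) ⊕ ι) (by simp; omega) α
    (fun k => (hα k).le) hαsum
  have hβsum := hreach.sum_eq_one hαsum
  obtain ⟨t, m, hm, hβ, hβ0, hβpos⟩ := hreach
  have hβδ' : ∀ k, δ ≤ β k := fun k => hβδ k (hβpos k (hα k))
  obtain ⟨y₀, rfl⟩ := mem_sLat.1 hyΛ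
  set V : Option (Fin d) ⊕ ι → Fin d → ℤ := Sum.elim W z with hV
  let r : ℤ := ⌊(1 + s * t) * θ / s⌋
  set θ' : ℝ := (1 + s * t) * θ - s * r with hθ'
  have hθ0 : 0 ≤ θ' := by
    have := Int.floor_le ((1 + s * t) * θ / s)
    rw [le_div_iff₀ hs0] at this
    change 0 ≤ (1 + s * t) * θ - s * r
    linarith
  have hθs : θ' ≤ s := by
    have := (Int.lt_floor_add_one ((1 + s * t) * θ / s)).le
    rw [div_le_iff₀ hs0] at this
    change (1 + s * t) * θ - s * r ≤ s
    linarith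
  let y₁ : Fin d → ℤ := (1 + s * t : ℤ) • y₀ + ∑ k, m k • V k - r • u
  have hy₁ : intVec ((s : ℤ) • y₁) = ∑ k, β k • intVec (V k) + θ' • intVec u := by
    have h1 : intVec ((s : ℤ) • y₁) = (1 + s * t : ℝ) • intVec ((s : ℤ) • y₀)
        + (s : ℝ) • ∑ k, (m k : ℝ) • intVec (V k) - (s * r : ℝ) • intVec u := by
      simp only [y₁, intVec_smul, intVec_sub, intVec_add, intVec_sum]
      push_cast
      module
    have h2 : ∑ k, β k • intVec (V k) = (1 + s * t : ℝ) • ∑ k, α k • intVec (V k)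
        + (s : ℝ) • ∑ k, (m k : ℝ) • intVec (V k) := by
      rw [Finset.smul_sum, Finset.smul_sum, ← Finset.sum_add_distrib]
      refine Finset.sum_congr rfl fun k _ => ?_
      rw [hβ]
      module
    rw [h1, hyeq, h2, hθ']
    module
  have hθτ : ∀ i, |θ' * τ i| ≤ s / N := by
    intro i
    rw [abs_mul, abs_of_nonneg hθ0]
    calc θ' * |τ i| ≤ s * (1 / N) := mul_le_mul hθs (hτ i) (abs_nonneg _) hs0.le
      _ = s / N := by ring
  have hsum_le : ∑ i, θ' * τ i ≤ d * (s / N) := by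
    calc ∑ i, θ' * τ i ≤ ∑ _i : Fin d, (s / N : ℝ) :=
          Finset.sum_le_sum fun i _ => (abs_le.1 (hθτ i)).2
      _ = d * (s / N) := by simp
  have hsplit : s * (d + 1) / (N : ℝ) = d * (s / N) + s / N := by ring
  have hsN : 0 ≤ (s : ℝ) / N := by positivity
  have hdsN : 0 ≤ d * ((s : ℝ) / N) := by positivity
  rw [Fintype.sum_sum_type, Fintype.sum_option] at hβsum hy₁
  have hint := mem_interior_of_pos_coeffs hP.1.2.1.convex he hw (v := fun k => intVec (z k))
    (fun i => by rw [← intVec_add]; exact hwe i) hz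
    (a := β (.inl none) - ∑ i, θ' * τ i) (b := fun i => β (.inl (some i)) + θ' * τ i)
    (c := fun k => β (.inr k)) (by linarith [hβδ' (.inl none)])
    (fun i => by linarith [hβδ' (.inl (some i)), (abs_le.1 (hθτ i)).1]) (fun k => hβ0 _)
    (by rw [Finset.sum_add_distrib]; linarith)
  have hyint : intVec ((s : ℤ) • y₁) ∈ interior P := by
    convert hint using 1
    rw [hy₁, hu]
    simp only [hV, W, Sum.elim_inl, Sum.elim_inr, Option.elim, intVec_add, add_smul, sub_smul,
      smul_add, Finset.sum_add_distrib, Finset.sum_smul, Finset.smul_sum, smul_smul]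
    abel
  have : intVec ((s : ℤ) • y₁) ∈ interior P ∩ sLat d s := ⟨hyint, mem_sLat.2 ⟨y₁, rfl⟩⟩
  rw [hP.1.2.2] at this
  exact this

end Frames

section FrameExistence

variable {d s : ℕ} {P : Set (Fin d → ℝ)}

/-- A full-dimensional simplex with integer vertices `w` and `w + e i` in `P`, such that the
edges `e i` with `i ∈ J` generate the integer directions of invariance of `P`. -/
structure IsFrame (P : Set (Fin d → ℝ)) (w : Fin d → ℤ) (e : Matrix (Fin d) (Fin d) ℤ)
    (J : Finset (Fin d)) : Prop where
  base_mem : intVec w ∈ P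
  vertex_mem : ∀ i, intVec (w + e i) ∈ P
  det_ne_zero : e.det ≠ 0
  lineality_eq : intLineality P = Submodule.span ℤ (e '' J)

theorem MemPifm.span_eq_top (hP : MemPifm d s P) {w : Fin d → ℤ} (hw : intVec w ∈ P) :
    Submodule.span ℚ ((Int.castAddHom ℚ).toIntLinearMap.compLeft (Fin d) ''
      {z | intVec (w + z) ∈ P}) = ⊤ := by
  by_contra hne
  obtain ⟨f, hf0, hf⟩ := Submodule.exists_le_ker_of_lt_top _ (lt_top_iff_ne_top.2 hne)
  obtain ⟨b, hb⟩ := IsLocalization.exist_integer_multiples_of_finite (nonZeroDivisors ℤ)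
    fun i : Fin d => f (Pi.single i 1)
  choose a ha using hb
  have hb0 : ((b : ℤ) : ℚ) ≠ 0 := by
    exact_mod_cast nonZeroDivisors.ne_zero b.2
  have ha' : ∀ i, (a i : ℚ) = (b : ℤ) * f (Pi.single i 1) := fun i => by
    simpa using ha i
  have hsum : ∀ x : Fin d → ℚ, f x = ∑ i, x i * f (Pi.single i 1) := fun x => by
    rw [LinearMap.pi_apply_eq_sum_univ f x]
    refine Finset.sum_congr rfl fun i _ => ?_
    congr 3
    ext j
    simp [Pi.single_apply, eq_comm]
  have ha0 : a = 0 := by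
    refine hP.eq_zero_of_forall_dotProduct hw fun z hz => ?_
    have h1 : f ((Int.castAddHom ℚ).toIntLinearMap.compLeft (Fin d) (z - w)) = 0 :=
      hf (Submodule.subset_span ⟨z - w, by simpa using hz, rfl⟩)
    rw [hsum] at h1
    have h2 : ((a ⬝ᵥ (z - w) : ℤ) : ℚ) = 0 := by
      rw [← mul_zero ((b : ℤ) : ℚ), ← h1, dotProduct, Finset.mul_sum, Int.cast_sum]
      refine Finset.sum_congr rfl fun i _ => ?_
      rw [Int.cast_mul, ha']
      simp
      ring
    exact_mod_cast h2
  refine hf0 (LinearMap.ext fun x => ?_)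
  rw [hsum, LinearMap.zero_apply]
  refine Finset.sum_eq_zero fun i _ => ?_
  have := ha' i
  rw [ha0, Pi.zero_apply, Int.cast_zero, eq_comm, mul_eq_zero] at this
  rw [this.resolve_left hb0, mul_zero]

theorem MemPifm.exists_isFrame (hP : MemPifm d s P) (hne : P.Nonempty) :
    ∃ w e J, IsFrame P w e J := by
  classical
  obtain ⟨w, hw⟩ : ∃ w, intVec w ∈ P := by
    by_contra! h
    obtain ⟨x, hx⟩ := hne
    exact (hP.1.2.1.subset_of_convex convex_empty fun z hz => (h z hz).elim) hx
  set ρ := (Int.castAddHom ℚ).toIntLinearMap.compLeft (Fin d) with hρ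
  have hρi : Function.Injective ρ := fun x y hxy => funext fun i => by
    simpa [hρ] using congrFun hxy i
  let b := Module.finBasis ℤ (intLineality P)
  have hind : LinearIndependent ℚ fun j => ρ (b j) := by
    rw [← LinearIndependent.iff_fractionRing ℤ ℚ]
    exact (b.linearIndependent.map' (intLineality P).subtype
      (Submodule.ker_subtype _)).map' ρ (LinearMap.ker_eq_bot.2 hρi)
  have hsub : range (fun j => ρ (b j)) ⊆ ρ '' {z | intVec (w + z) ∈ P} := by
    rintro _ ⟨j, rfl⟩
    refine ⟨b j, ?_, rfl⟩
    simpa using (b j).2 _ hw 1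
  obtain ⟨B, hBT, hbB, hTB, hB⟩ := exists_linearIndepOn_id_extension hind.linearIndepOn_id hsub
  have htop : ⊤ ≤ Submodule.span ℚ (range ((↑) : B → Fin d → ℚ)) := by
    rw [Subtype.range_coe, ← hP.span_eq_top hw]
    exact Submodule.span_le.2 hTB
  let bB := Module.Basis.mk hB htop
  let σ : Fin d ≃ B := (Pi.basisFun ℚ (Fin d)).indexEquiv bB
  choose e he heσ using fun k => hBT (σ k).2
  refine ⟨w, e, Finset.univ.filter fun k => ρ (e k) ∈ range fun j => ρ (b j), hw, he, ?_, ?_⟩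
  · have h1 : LinearIndependent ℚ (Matrix.map e (Int.castRingHom ℚ)).row := by
      have h2 : LinearIndependent ℚ fun k => (σ k : Fin d → ℚ) := hB.comp σ σ.injective
      rwa [← funext heσ] at h2
    rw [Matrix.linearIndependent_rows_iff_isUnit, Matrix.isUnit_iff_isUnit_det,
      isUnit_iff_ne_zero] at h1
    intro h0
    have h3 := RingHom.map_det (Int.castRingHom ℚ) e
    rw [h0, map_zero] at h3
    exact h1 h3.symm
  · refine le_antisymm ?_ (Submodule.span_le.2 ?_)
    · have h1 : intLineality P = Submodule.span ℤ (range fun j => (b j : Fin d → ℤ)) := by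
        have := congrArg (Submodule.map (intLineality P).subtype) b.span_eq
        rw [Submodule.map_subtype_top, Submodule.map_span, ← range_comp] at this
        exact this.symm
      refine h1.trans_le (Submodule.span_mono ?_)
      rintro _ ⟨j, rfl⟩
      have h2 : ρ (b j) ∈ B := hbB ⟨j, rfl⟩
      have h3 : ρ (e (σ.symm ⟨_, h2⟩)) = ρ (b j) := by rw [heσ, Equiv.apply_symm_apply]
      exact ⟨σ.symm ⟨_, h2⟩, by simp [h3], hρi h3⟩
    · rintro _ ⟨k, hk, rfl⟩
      obtain ⟨j, hj⟩ := (Finset.mem_filter.1 hk).2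
      rw [← hρi hj]
      exact (b j).2

end FrameExistence

section FrameBounds

variable {d s : ℕ} {P : Set (Fin d → ℝ)} {w : Fin d → ℤ} {e : Matrix (Fin d) (Fin d) ℤ}
  {J : Finset (Fin d)}

/-- The exponents of the quotients of `ℤ^d` by the lattices generated by frames are bounded. -/
theorem exists_uniform_frame_exponent (d s : ℕ) (hs : 1 ≤ s) :
    ∃ E : ℕ, 1 ≤ E ∧ ∀ P : Set (Fin d → ℝ), MemPifm d s P → ∀ w e J, IsFrame P w e J →
      ∀ x : Fin d → ℤ, ∃ c : Fin d → ℤ, (E : ℤ) • x = ∑ i, c i • e i := by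
  obtain ⟨N, hN, hsmall⟩ := exists_small_coords_mem_intLineality d s hs
  refine ⟨(N ^ d).factorial, Nat.factorial_pos _, fun P hP w e J hF x => ?_⟩
  obtain ⟨T, hT⟩ := exists_linear_coords hF.det_ne_zero
  obtain ⟨t, ht1, htN, m, hm⟩ := exists_simultaneous_approx (T (intVec x)) N hN
  rw [Fintype.card_fin] at htN
  have hu : (t : ℤ) • x - ∑ i, m i • e i ∈ intLineality P := by
    refine hsmall P hP w e hF.base_mem hF.vertex_mem hF.det_ne_zero _
      (fun i => t * T (intVec x) i - m i) ?_ hm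
    rw [intVec_sub, intVec_smul, intVec_sum]
    conv_lhs => rw [hT (intVec x)]
    simp only [intVec_smul, sub_smul, mul_smul, Finset.sum_sub_distrib, Finset.smul_sum,
      Int.cast_natCast]
  rw [hF.lineality_eq] at hu
  have hx : (t : ℤ) • x ∈ Submodule.span ℤ (range e) := by
    rw [← sub_add_cancel ((t : ℤ) • x) (∑ i, m i • e i)]
    exact add_mem (Submodule.span_mono (image_subset_range _ _) hu)
      (sum_mem fun i _ => Submodule.smul_mem _ _ (Submodule.subset_span ⟨i, rfl⟩))
  obtain ⟨k, hk⟩ := Nat.dvd_factorial ht1 htN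
  have hx' : ((N ^ d).factorial : ℤ) • x ∈ Submodule.span ℤ (range e) := by
    rw [hk, Nat.cast_mul, mul_comm, mul_smul]
    exact Submodule.smul_mem _ _ hx
  obtain ⟨c, hc⟩ := (Submodule.mem_span_range_iff_exists_fun ℤ).1 hx'
  exact ⟨c, hc.symm⟩

theorem mul_det_updateRow_of_smul_eq_sum {E : ℤ} {x c : Fin d → ℤ} (h : E • x = ∑ i, c i • e i)
    (i : Fin d) : E * (e.updateRow i x).det = c i * e.det := by
  rw [← Matrix.det_updateRow_smul, h, Matrix.det_updateRow_sum, smul_eq_mul]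

theorem IsFrame.updateRow (hF : IsFrame P w e J) {i : Fin d} (hi : i ∉ J) {z : Fin d → ℤ}
    (hz : intVec z ∈ P) (hdet : (e.updateRow i (z - w)).det ≠ 0) :
    IsFrame P w (e.updateRow i (z - w)) J where
  base_mem := hF.base_mem
  vertex_mem k := by
    obtain rfl | hk := eq_or_ne k i
    · rwa [Matrix.updateRow_self, add_sub_cancel]
    · rw [Matrix.updateRow_ne hk]
      exact hF.vertex_mem k
  det_ne_zero := hdet
  lineality_eq := by
    rw [hF.lineality_eq]
    have : e '' J = e.updateRow i (z - w) '' J := image_congr fun k hk =>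
      (Matrix.updateRow_ne fun h : k = i => hi (h ▸ hk)).symm
    rw [this]

theorem IsFrame.abs_coeff_le (hF : IsFrame P w e J) {E : ℕ} (hE : 1 ≤ E)
    (hexp : ∀ e', IsFrame P w e' J →
      ∀ x : Fin d → ℤ, ∃ c : Fin d → ℤ, (E : ℤ) • x = ∑ i, c i • e' i)
    {z : Fin d → ℤ} (hz : intVec z ∈ P) {c : Fin d → ℤ}
    (hc : (E : ℤ) • (z - w) = ∑ i, c i • e i) {i : Fin d} (hi : i ∉ J) :
    |c i| ≤ E ^ 2 := by
  obtain h0 | h0 := eq_or_ne (c i) 0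
  · rw [h0, abs_zero]
    positivity
  have hdet := mul_det_updateRow_of_smul_eq_sum hc i
  have hdet0 : (e.updateRow i (z - w)).det ≠ 0 := by
    intro h
    rw [h, mul_zero, eq_comm] at hdet
    exact mul_ne_zero h0 hF.det_ne_zero hdet
  obtain ⟨c', hc'⟩ := hexp _ (hF.updateRow hi hz hdet0) (e i)
  have hdet' := mul_det_updateRow_of_smul_eq_sum hc' i
  rw [Matrix.updateRow_idem, Matrix.updateRow_eq_self] at hdet'
  have hmul : (E : ℤ) ^ 2 = c' i * c i := by
    refine mul_right_cancel₀ hF.det_ne_zero ?_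
    linear_combination (E : ℤ) * hdet' + c' i * hdet
  refine Int.le_of_dvd (by positivity) ((abs_dvd _ _).2 ⟨c' i, ?_⟩)
  rw [hmul, mul_comm]

end FrameBounds

section Equivalence

variable {d s : ℕ} {P P' : Set (Fin d → ℝ)} {w w' : Fin d → ℤ} {e e' : Matrix (Fin d) (Fin d) ℤ}
  {J : Finset (Fin d)}

theorem affMap_eq_mulVec_add (U : Matrix (Fin d) (Fin d) ℤ) (t x : Fin d → ℝ) :
    affMap U t x = (U.map (Int.castRingHom ℝ)).mulVec x + t := rfl

theorem affMap_intVec (U : Matrix (Fin d) (Fin d) ℤ) (v z : Fin d → ℤ) :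
    affMap U (intVec v) (intVec z) = intVec (U.mulVec z + v) := by
  ext i
  simp [affMap, Matrix.mulVec, dotProduct]

theorem Convex.preimage_affMap (hP : Convex ℝ P) (U : Matrix (Fin d) (Fin d) ℤ)
    (t : Fin d → ℝ) : Convex ℝ {x | affMap U t x ∈ P} := by
  intro x hx y hy a b ha hb hab
  suffices h : affMap U t (a • x + b • y) = a • affMap U t x + b • affMap U t y by
    rw [mem_ofPred_eq, h]
    exact hP hx hy ha hb hab
  simp only [affMap_eq_mulVec_add, Matrix.mulVec_add, Matrix.mulVec_smul]
  obtain rfl : b = 1 - a := by linarith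
  module

/-- Congruent frames are related by an integer matrix congruent to the identity. -/
theorem exists_mulVec_eq_of_congr {E : ℕ} (he : e.det ≠ 0)
    (hexp : ∀ x : Fin d → ℤ, ∃ c : Fin d → ℤ, (E : ℤ) • x = ∑ i, c i • e i)
    {X : Matrix (Fin d) (Fin d) ℤ} (he' : e' = e + ((E : ℤ) * s) • X) :
    ∃ Y : Matrix (Fin d) (Fin d) ℤ, ∀ i, (1 + (s : ℤ) • Y).mulVec (e i) = e' i := by
  obtain ⟨B, hB⟩ : ∃ B : Matrix (Fin d) (Fin d) ℤ,
      ∀ k, (E : ℤ) • Pi.single k 1 = ∑ i, B k i • e i :=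
    ⟨fun k => (hexp (Pi.single k 1)).choose, fun k => (hexp (Pi.single k 1)).choose_spec⟩
  have hBe : B * e = (E : ℤ) • 1 := by
    ext k j
    have := congrFun (hB k) j
    simp only [Finset.sum_apply, Pi.smul_apply] at this
    rw [Matrix.mul_apply, Matrix.smul_apply, Matrix.one_apply]
    simpa [Pi.single_apply, eq_comm] using this.symm
  have heB : e * B = (E : ℤ) • 1 := by
    have h1 : e.det • (e * B) = e.det • ((E : ℤ) • 1) := by
      calc e.det • (e * B)
          = e * (B * e) * e.adjugate := by
            rw [← Matrix.mul_assoc, Matrix.mul_assoc, Matrix.mul_adjugate, Matrix.mul_smul,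
              Matrix.mul_one]
        _ = e.det • ((E : ℤ) • 1) := by
            rw [hBe, Matrix.mul_smul, Matrix.mul_one, Matrix.smul_mul, Matrix.mul_adjugate,
              smul_comm]
    exact smul_right_injective _ he h1
  refine ⟨(B * X).transpose, fun i => ?_⟩
  have h2 : e * (1 + (s : ℤ) • (B * X)) = e' := by
    rw [he', Matrix.mul_add, Matrix.mul_one, Matrix.mul_smul, ← Matrix.mul_assoc, heB,
      Matrix.smul_mul, Matrix.one_mul, smul_smul, mul_comm]
  have h3 : 1 + (s : ℤ) • (B * X).transpose = (1 + (s : ℤ) • (B * X)).transpose := by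
    rw [Matrix.transpose_add, Matrix.transpose_smul, Matrix.transpose_one]
  rw [← h2, h3, Matrix.mulVec_transpose]
  rfl

theorem mul_eq_one_of_frames {E : ℕ} (hE : 1 ≤ E)
    (hexp : ∀ x : Fin d → ℤ, ∃ c : Fin d → ℤ, (E : ℤ) • x = ∑ i, c i • e i)
    {U V : Matrix (Fin d) (Fin d) ℤ} (hU : ∀ i, U.mulVec (e i) = e' i)
    (hV : ∀ i, V.mulVec (e' i) = e i) : V * U = 1 := by
  refine Matrix.toLin'.injective (LinearMap.ext fun x => ?_)
  obtain ⟨c, hc⟩ := hexp x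
  have hE0 : (E : ℤ) ≠ 0 := by positivity
  refine smul_right_injective _ hE0 ?_
  simp only [← map_smul, hc]
  simp only [map_sum, map_smul, Matrix.toLin'_apply, ← Matrix.mulVec_mulVec, hU, hV,
    Matrix.one_mulVec]

/-- The bounded coordinate vectors, with respect to a frame, of integer points of `P`. -/
def coeffSet (P : Set (Fin d → ℝ)) (E : ℕ) (w : Fin d → ℤ) (e : Matrix (Fin d) (Fin d) ℤ) :
    Set (Fin d → Icc (-(E : ℤ) ^ 2) ((E : ℤ) ^ 2)) :=
  {c | ∃ z, intVec z ∈ P ∧ (E : ℤ) • (z - w) = ∑ i, (c i : ℤ) • e i}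

theorem intVec_add_mem (hP : intLineality P = Submodule.span ℤ (e '' J)) {z : Fin d → ℤ}
    (hz : intVec z ∈ P) {q : Fin d → ℤ} (hq : ∀ i, i ∉ J → q i = 0) :
    intVec (z + ∑ i, q i • e i) ∈ P := by
  have h1 : ∑ i, q i • e i ∈ intLineality P := by
    rw [hP]
    refine sum_mem fun i _ => ?_
    by_cases hi : i ∈ J
    · exact Submodule.smul_mem _ _ (Submodule.subset_span ⟨i, hi, rfl⟩)
    · rw [hq i hi, zero_smul]
      exact zero_mem _
  simpa only [one_smul, intVec_add] using h1 _ hz 1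

theorem IsFrame.intVec_mulVec_add_mem (hF : IsFrame P w e J) (hF' : IsFrame P' w' e' J) {E : ℕ}
    (hE : 1 ≤ E) (hexp : ∀ e', IsFrame P w e' J →
      ∀ x : Fin d → ℤ, ∃ c : Fin d → ℤ, (E : ℤ) • x = ∑ i, c i • e' i)
    (hC : coeffSet P E w e ⊆ coeffSet P' E w' e') {U : Matrix (Fin d) (Fin d) ℤ}
    {v : Fin d → ℤ} (hU : ∀ i, U.mulVec (e i) = e' i) (hw : U.mulVec w + v = w')
    {z : Fin d → ℤ} (hz : intVec z ∈ P) : intVec (U.mulVec z + v) ∈ P' := by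
  classical
  have hE0 : (0 : ℤ) < E := by positivity
  obtain ⟨c, hc⟩ := hexp e hF (z - w)
  let q : Fin d → ℤ := fun i => if i ∈ J then c i / E else 0
  have hq : ∀ i, i ∉ J → q i = 0 := fun i hi => if_neg hi
  have hz₀ : intVec (z + ∑ i, (-q) i • e i) ∈ P :=
    intVec_add_mem hF.lineality_eq hz fun i hi => by rw [Pi.neg_apply, hq i hi, neg_zero]
  have hcb : ∀ i, c i - E * q i ∈ Icc (-(E : ℤ) ^ 2) ((E : ℤ) ^ 2) := by
    intro i
    by_cases hi : i ∈ J
    · have h1 : c i - E * q i = c i % E := by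
        rw [Int.emod_def]
        simp only [q, if_pos hi]
      have h2 := Int.emod_nonneg (c i) hE0.ne'
      have h3 := Int.emod_lt_of_pos (c i) hE0
      rw [h1]
      constructor <;> nlinarith
    · rw [hq i hi, mul_zero, sub_zero]
      exact abs_le.1 (hF.abs_coeff_le hE hexp hz hc hi)
  have hmem : (fun i => ⟨_, hcb i⟩ : Fin d → Icc (-(E : ℤ) ^ 2) ((E : ℤ) ^ 2)) ∈
      coeffSet P E w e := by
    refine ⟨_, hz₀, ?_⟩
    rw [add_sub_right_comm, smul_add, hc, Finset.smul_sum, ← Finset.sum_add_distrib]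
    refine Finset.sum_congr rfl fun i _ => ?_
    simp only [Pi.neg_apply]
    module
  obtain ⟨z', hz', hzc⟩ := hC hmem
  have hzz : U.mulVec z + v = z' + ∑ i, q i • e' i := by
    refine smul_right_injective _ hE0.ne' ?_
    have h1 : z' = (z' - w') + (U.mulVec w + v) := by rw [hw, sub_add_cancel]
    have h2 : z = (z - w) + w := by rw [sub_add_cancel]
    have h3 : (E : ℤ) • U.mulVec (z - w) = ∑ i, c i • e' i := by
      rw [← Matrix.mulVec_smul, hc, Matrix.mulVec_sum]
      simp only [Matrix.mulVec_smul, hU]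
    simp only
    rw [h1]
    conv_lhs => rw [h2]
    rw [Matrix.mulVec_add, smul_add, smul_add, h3, smul_add, smul_add, hzc]
    simp only [sub_smul, mul_smul, Finset.sum_sub_distrib, Finset.smul_sum, smul_add]
    abel
  rw [hzz]
  exact intVec_add_mem hF'.lineality_eq hz' hq

theorem exists_image_affMap_eq_of_frames {E : ℕ} (hE : 1 ≤ E) (hP : IsIntegralPoly P)
    (hP' : IsIntegralPoly P') (hF : IsFrame P w e J) (hF' : IsFrame P' w' e' J)
    (hexp : ∀ e', IsFrame P w e' J →
      ∀ x : Fin d → ℤ, ∃ c : Fin d → ℤ, (E : ℤ) • x = ∑ i, c i • e' i)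
    (hexp' : ∀ e, IsFrame P' w' e J →
      ∀ x : Fin d → ℤ, ∃ c : Fin d → ℤ, (E : ℤ) • x = ∑ i, c i • e i)
    (hC : coeffSet P E w e = coeffSet P' E w' e') {y : Fin d → ℤ} (hw : w' = w + (s : ℤ) • y)
    {X : Matrix (Fin d) (Fin d) ℤ} (he : e' = e + ((E : ℤ) * s) • X) :
    ∃ (U : Matrix (Fin d) (Fin d) ℤ) (v : Fin d → ℤ), |U.det| = 1 ∧
      P' = affMap U (intVec ((s : ℤ) • v)) '' P := by
  obtain ⟨Y, hU⟩ := exists_mulVec_eq_of_congr hF.det_ne_zero (hexp e hF) he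
  obtain ⟨Z, hV⟩ := exists_mulVec_eq_of_congr (e' := e) (X := -X) hF'.det_ne_zero (hexp' e' hF')
    (by rw [he, smul_neg, add_neg_cancel_right])
  have hVU := mul_eq_one_of_frames hE (hexp e hF) hU hV
  have hUV := mul_eq_one_of_frames hE (hexp' e' hF') hV hU
  have hUw : (1 + (s : ℤ) • Y).mulVec w + (s : ℤ) • (y - Y.mulVec w) = w' := by
    rw [hw, Matrix.add_mulVec, Matrix.one_mulVec, Matrix.smul_mulVec]
    module
  generalize 1 + (s : ℤ) • Y = U at *
  generalize 1 + (s : ℤ) • Z = V at *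
  generalize y - Y.mulVec w = v at *
  have hVw : V.mulVec w' + -V.mulVec ((s : ℤ) • v) = w := by
    rw [← hUw, Matrix.mulVec_add, Matrix.mulVec_mulVec, hVU, Matrix.one_mulVec,
      add_neg_cancel_right]
  refine ⟨U, v, Int.isUnit_iff_abs_eq.1 ?_, ?_⟩
  · refine IsUnit.of_mul_eq_one V.det ?_
    rw [← Matrix.det_mul, hUV, Matrix.det_one]
  · have h1 : P ⊆ {x | affMap U (intVec ((s : ℤ) • v)) x ∈ P'} :=
      hP.subset_of_convex (hP'.convex.preimage_affMap U _) fun z hz => by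
        rw [mem_ofPred_eq, affMap_intVec]
        exact hF.intVec_mulVec_add_mem hF' hE hexp hC.le hU hUw hz
    have h2 : P' ⊆ {x | affMap V (intVec (-V.mulVec ((s : ℤ) • v))) x ∈ P} :=
      hP'.subset_of_convex (hP.convex.preimage_affMap V _) fun z hz => by
        rw [mem_ofPred_eq, affMap_intVec]
        exact hF'.intVec_mulVec_add_mem hF hE hexp' hC.ge hV hVw hz
    refine subset_antisymm (fun x hx => ⟨_, h2 hx, ?_⟩) (image_subset_iff.2 h1)
    rw [← zero_sub, intVec_sub, intVec_zero, zero_sub]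
    have h3 : intVec (V.mulVec ((s : ℤ) • v)) =
        (V.map (Int.castRingHom ℝ)).mulVec (intVec ((s : ℤ) • v)) := by
      have := affMap_intVec V 0 ((s : ℤ) • v)
      rw [add_zero, intVec_zero, affMap_eq_mulVec_add, add_zero] at this
      exact this.symm
    have h4 : U.map (Int.castRingHom ℝ) * V.map (Int.castRingHom ℝ) = 1 := by
      rw [← Matrix.map_mul, hUV, Matrix.map_one _ (map_zero _) (map_one _)]
    rw [h3, affMap_eq_mulVec_add, affMap_eq_mulVec_add, Matrix.mulVec_add, Matrix.mulVec_neg,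
      Matrix.mulVec_mulVec, Matrix.mulVec_mulVec, h4, Matrix.one_mulVec, Matrix.one_mulVec,
      neg_add_cancel_right]

end Equivalence

section Finiteness

theorem exists_finite_representatives {α ι : Type*} [Finite ι] {p : α → Prop} {R : α → ι → Prop}
    (hR : ∀ a, p a → ∃ i, R a i) :
    ∃ (N : ℕ) (q : Fin N → α), (∀ j, p (q j)) ∧ ∀ a, p a → ∃ j i, R (q j) i ∧ R a i := by
  choose q hq using fun i : {i // ∃ a, p a ∧ R a i} => i.2
  let σ := Finite.equivFin {i // ∃ a, p a ∧ R a i}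
  refine ⟨_, fun j => q (σ.symm j), fun j => (hq _).1, fun a ha => ?_⟩
  obtain ⟨i, hi⟩ := hR a ha
  refine ⟨σ ⟨i, a, ha, hi⟩, i, ?_, hi⟩
  simpa using (hq ⟨i, a, ha, hi⟩).2

/-- The finitely many data of a frame of `P` which determine `P` up to lattice-preserving affine
transformations. -/
def HasInvariant {d : ℕ} (s E : ℕ) (P : Set (Fin d → ℝ)) :
    Option ((Fin d → ZMod s) × (Fin d → Fin d → ZMod (E * s)) × Finset (Fin d) ×
      Set (Fin d → Icc (-(E : ℤ) ^ 2) ((E : ℤ) ^ 2))) → Prop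
  | none => P = ∅
  | some (a, b, J, C) => ∃ w e, IsFrame P w e J ∧ (∀ i, (w i : ZMod s) = a i) ∧
      (∀ i j, (e i j : ZMod (E * s)) = b i j) ∧ coeffSet P E w e = C

end Finiteness

/-- `𝒫_ifm(s,d)` modulo `Λ`-preserving affine transformations is finite. -/
theorem Pifm_finite_up_to_lattice_preserving_transformations (d s : ℕ) (hs : 1 ≤ s) :
    ∃ (N : ℕ) (Qs : Fin N → Set (Fin d → ℝ)),
      (∀ j, MemPifm d s (Qs j)) ∧
      ∀ P : Set (Fin d → ℝ), MemPifm d s P →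
        ∃ (U : Matrix (Fin d) (Fin d) ℤ) (v : Fin d → ℤ) (j : Fin N),
          |U.det| = 1 ∧ P = affMap U (fun i => (s : ℝ) * (v i : ℝ)) '' Qs j := by
  obtain ⟨E, hE, hexp⟩ := exists_uniform_frame_exponent d s hs
  have : NeZero s := ⟨by omega⟩
  have : NeZero (E * s) := ⟨by positivity⟩
  obtain ⟨N, Qs, hQs, hrep⟩ := exists_finite_representatives (p := MemPifm d s)
    (R := HasInvariant s E) fun P hP => by
      rcases P.eq_empty_or_nonempty with rfl | hne
      · exact ⟨none, rfl⟩
      · obtain ⟨w, e, J, hF⟩ := hP.exists_isFrame hne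
        exact ⟨some (_, _, J, _), w, e, hF, fun _ => rfl, fun _ _ => rfl, rfl⟩
  refine ⟨N, Qs, hQs, fun P hP => ?_⟩
  obtain ⟨j, _ | ⟨a, b, J, C⟩, hj, hPj⟩ := hrep P hP
  · obtain rfl : P = ∅ := hPj
    have hQ : Qs j = ∅ := hj
    exact ⟨1, 0, j, by simp, by rw [hQ, image_empty]⟩
  · obtain ⟨w, e, hF, hw, he, hC⟩ := hj
    obtain ⟨w', e', hF', hw', he', hC'⟩ := hPj
    choose y hy using fun i => (ZMod.intCast_eq_intCast_iff_dvd_sub (w i) (w' i) s).1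
      ((hw i).trans (hw' i).symm)
    choose X hX using fun i k => (ZMod.intCast_eq_intCast_iff_dvd_sub (e i k) (e' i k) (E * s)).1
      ((he i k).trans (he' i k).symm)
    obtain ⟨U, v, hU, hPU⟩ := exists_image_affMap_eq_of_frames (X := Matrix.of X) (y := y) hE
      (hQs j).1.2.1 hP.1.2.1 hF hF' (fun e' h => hexp _ (hQs j) w e' J h)
      (fun e' h => hexp _ hP w' e' J h) (hC.trans hC'.symm)
      (funext fun i => by
        rw [Pi.add_apply, Pi.smul_apply, smul_eq_mul, ← hy, add_sub_cancel])
      (Matrix.ext fun i k => by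
        have := hX i k
        rw [Nat.cast_mul] at this
        rw [Matrix.add_apply, Matrix.smul_apply, Matrix.of_apply, smul_eq_mul, ← this,
          add_sub_cancel])
    refine ⟨U, v, j, hU, hPU.trans ?_⟩
    congr 2
    ext i
    simp
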